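/- Suppose Φ : [0,∞) → ℝ is convex and induces a Φ-entropy that is both subadditive and homogeneous. Let (μᵢ,Kᵢ), i = 1,…,n, be admissible pairs with μᵢ a strictly positive distribution on a finite set Xᵢ and Kᵢ a channel from Xᵢ to Xᵢ, and let p = (p₁,…,pₙ) be a probability vector. Define the channel K on X₁×⋯×Xₙ by K(x'₁,…,x'ₙ | x₁,…,xₙ) = Σᵢ pᵢ·Kᵢ(x'ᵢ|xᵢ)·Π_{j≠i} 1{x'ⱼ = xⱼ} (i.e., K = Σᵢ pᵢ (id₁⊗⋯⊗Kᵢ⊗⋯⊗idₙ)). Then 1 − η_Φ(μ₁⊗⋯⊗μₙ, K) ≥ min_{1 ≤ i ≤ n} pᵢ·(1 − η_Φ(μᵢ,Kᵢ)). -/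

import Mathlib

open Finset

noncomputable section

namespace SDPI

variable {X Y : Type} [Fintype X] [Fintype Y]

def IsDist (μ : X → ℝ) : Prop := (∀ x, 0 ≤ μ x) ∧ ∑ x, μ x = 1

def IsPosDist (μ : X → ℝ) : Prop := (∀ x, 0 < μ x) ∧ ∑ x, μ x = 1

def IsChannel (K : X → Y → ℝ) : Prop :=
  (∀ x y, 0 ≤ K x y) ∧ ∀ x, ∑ y, K x y = 1

def push (μ : X → ℝ) (K : X → Y → ℝ) : Y → ℝ := fun y => ∑ x, μ x * K x y

def fDiv (Φ : ℝ → ℝ) (ν μ : X → ℝ) : ℝ := (∑ x, μ x * Φ (ν x / μ x)) - Φ 1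

def eta (Φ : ℝ → ℝ) (μ : X → ℝ) (K : X → Y → ℝ) : ℝ :=
  sSup { r | ∃ ν : X → ℝ, IsDist ν ∧ ν ≠ μ ∧
    r = fDiv Φ (push ν K) (push μ K) / fDiv Φ ν μ }

def etaSup (Φ : ℝ → ℝ) (K : X → Y → ℝ) : ℝ :=
  sSup { r | ∃ μ : X → ℝ, IsPosDist μ ∧ r = eta Φ μ K }

def maxCorr (μ : X → ℝ) (K : X → Y → ℝ) : ℝ :=
  sSup { r | ∃ (f : X → ℝ) (g : Y → ℝ),
    (∑ x, μ x * f x) = 0 ∧ (∑ y, push μ K y * g y) = 0 ∧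
    (∑ x, μ x * (f x) ^ 2) = 1 ∧ (∑ y, push μ K y * (g y) ^ 2) = 1 ∧
    r = ∑ x, ∑ y, μ x * K x y * (f x * g y) }

def adjoint (μ : X → ℝ) (K : X → Y → ℝ) : Y → X → ℝ :=
  fun y x => K x y * μ x / push μ K y

def Ent (Φ : ℝ → ℝ) (μ : X → ℝ) (f : X → ℝ) : ℝ :=
  (∑ x, μ x * Φ (f x)) - Φ (∑ x, μ x * f x)

def Var (μ : X → ℝ) (f : X → ℝ) : ℝ :=
  ∑ x, μ x * (f x - ∑ x', μ x' * f x') ^ 2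

def condExp (μ : X → ℝ) (K : X → Y → ℝ) (f : X → ℝ) : Y → ℝ :=
  fun y => (∑ x, μ x * K x y * f x) / push μ K y

def calE (μ : X → ℝ) (K : X → Y → ℝ) (f g : X → ℝ) : ℝ :=
  ∑ x, ∑ y, μ x * K x y *
    ((f x - condExp μ K f y) * (g x - condExp μ K g y))

def dirichlet (μ : X → ℝ) (M : X → X → ℝ) (f g : X → ℝ) : ℝ :=
  (1 / 2) * ∑ x, ∑ x', μ x * M x x' * ((f x - f x') * (g x - g x'))

def Homogeneous (Φ : ℝ → ℝ) : Prop :=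
  ∃ κ : ℝ → ℝ, (∀ c : ℝ, 0 < c → 0 < κ c) ∧
    ∀ (c : ℝ), 0 < c → ∀ (Z : Type) [Fintype Z], ∀ (μ : Z → ℝ),
      IsDist μ → ∀ f : Z → ℝ, (∀ z, 0 ≤ f z) →
        Ent Φ μ (fun z => c * f z) = κ c * Ent Φ μ f

def Subadditive (Φ : ℝ → ℝ) : Prop :=
  ∀ (n : ℕ) (Z : Fin n → Type) [∀ i, Fintype (Z i)],
    ∀ (μ : ∀ i, Z i → ℝ), (∀ i, IsDist (μ i)) →
    ∀ f : (∀ i, Z i) → ℝ, (∀ z, 0 ≤ f z) →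
      Ent Φ (fun z : ∀ i, Z i => ∏ i, μ i (z i)) f ≤
        ∑ i : Fin n,
          ((∑ z : ∀ j, Z j, (∏ j, μ j (z j)) * Φ (f z)) -
            ∑ z : ∀ j, Z j, (∏ j, μ j (z j)) *
              Φ (∑ w : Z i, μ i w * f (Function.update z i w)))


/-- Jensen's inequality for unnormalized weights (which may all vanish). -/
lemma sum_mul_map_div_le {ι : Type*} [Fintype ι] {Φ : ℝ → ℝ}
    (hconv : ConvexOn ℝ (Set.Ici 0) Φ) {w a : ι → ℝ} (hw : ∀ i, 0 ≤ w i) (ha : ∀ i, 0 ≤ a i) :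
    (∑ i, w i) * Φ ((∑ i, w i * a i) / ∑ i, w i) ≤ ∑ i, w i * Φ (a i) := by
  rcases (Finset.sum_nonneg fun i _ => hw i : 0 ≤ ∑ i, w i).eq_or_lt with h | h
  · have hw0 : ∀ i, w i = 0 := fun i =>
      (Finset.sum_eq_zero_iff_of_nonneg fun i _ => hw i).1 h.symm i (mem_univ i)
    simp [hw0]
  · have key := hconv.map_sum_le (t := univ) (w := fun i => w i / ∑ i, w i) (p := a)
      (fun i _ => div_nonneg (hw i) h.le) (by rw [← Finset.sum_div, div_self h.ne'])
      (fun i _ => ha i)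
    simp only [smul_eq_mul, div_mul_eq_mul_div, ← Finset.sum_div] at key
    rw [le_div_iff₀ h] at key
    linarith

lemma Ent_nonneg {Φ : ℝ → ℝ} (hconv : ConvexOn ℝ (Set.Ici 0) Φ) {μ f : X → ℝ}
    (hμ : IsDist μ) (hf : ∀ x, 0 ≤ f x) : 0 ≤ Ent Φ μ f := by
  have := sum_mul_map_div_le hconv hμ.1 hf
  rw [hμ.2, one_mul, div_one] at this
  exact sub_nonneg.2 this

lemma IsPosDist.isDist {μ : X → ℝ} (h : IsPosDist μ) : IsDist μ :=
  ⟨fun x => (h.1 x).le, h.2⟩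

lemma IsDist.push {μ : X → ℝ} {K : X → Y → ℝ} (hμ : IsDist μ) (hK : IsChannel K) :
    IsDist (push μ K) := by
  refine ⟨fun y => Finset.sum_nonneg fun x _ => mul_nonneg (hμ.1 x) (hK.1 x y), ?_⟩
  simp only [SDPI.push]
  rw [Finset.sum_comm]
  simp [← Finset.mul_sum, hK.2, hμ.2]

lemma fDiv_nonneg {Φ : ℝ → ℝ} (hconv : ConvexOn ℝ (Set.Ici 0) Φ) {ν μ : X → ℝ}
    (hμ : IsPosDist μ) (hν : IsDist ν) : 0 ≤ fDiv Φ ν μ := by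
  have h := Ent_nonneg hconv hμ.isDist (f := fun x => ν x / μ x)
    fun x => div_nonneg (hν.1 x) (hμ.1 x).le
  have hs : ∑ x, μ x * (ν x / μ x) = 1 := by
    rw [← hν.2]
    exact Finset.sum_congr rfl fun x _ => mul_div_cancel₀ _ (hμ.1 x).ne'
  rwa [Ent, hs] at h

/-- The data processing inequality. -/
lemma fDiv_push_le {Φ : ℝ → ℝ} (hconv : ConvexOn ℝ (Set.Ici 0) Φ) {ν μ : X → ℝ} {K : X → Y → ℝ}
    (hμ : IsPosDist μ) (hν : IsDist ν) (hK : IsChannel K) :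
    fDiv Φ (push ν K) (push μ K) ≤ fDiv Φ ν μ := by
  refine sub_le_sub_right ?_ _
  calc ∑ y, push μ K y * Φ (push ν K y / push μ K y)
      ≤ ∑ y, ∑ x, μ x * K x y * Φ (ν x / μ x) := by
        refine Finset.sum_le_sum fun y _ => ?_
        have h := sum_mul_map_div_le hconv (w := fun x => μ x * K x y) (a := fun x => ν x / μ x)
          (fun x => mul_nonneg (hμ.1 x).le (hK.1 x y)) fun x => div_nonneg (hν.1 x) (hμ.1 x).le
        have e : ∑ x, μ x * K x y * (ν x / μ x) = push ν K y := by
          refine Finset.sum_congr rfl fun x _ => ?_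
          have := (hμ.1 x).ne'
          field_simp
        rwa [e] at h
    _ = ∑ x, μ x * Φ (ν x / μ x) := by
        rw [Finset.sum_comm]
        refine Finset.sum_congr rfl fun x _ => ?_
        rw [← Finset.sum_mul, ← Finset.mul_sum, hK.2, mul_one]

section eta

variable {Φ : ℝ → ℝ} {μ : X → ℝ} {K : X → Y → ℝ}

lemma fDiv_push_div_mem_Icc (hconv : ConvexOn ℝ (Set.Ici 0) Φ)
    (hμ : IsPosDist μ) (hK : IsChannel K) (hq : ∀ y, 0 < push μ K y)
    {ν : X → ℝ} (hν : IsDist ν) :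
    fDiv Φ (push ν K) (push μ K) / fDiv Φ ν μ ∈ Set.Icc (0 : ℝ) 1 :=
  ⟨div_nonneg (fDiv_nonneg hconv ⟨hq, (hμ.isDist.push hK).2⟩ (hν.push hK))
      (fDiv_nonneg hconv hμ hν),
    div_le_one_of_le₀ (fDiv_push_le hconv hμ hν hK) (fDiv_nonneg hconv hμ hν)⟩

lemma eta_mem_Icc (hconv : ConvexOn ℝ (Set.Ici 0) Φ)
    (hμ : IsPosDist μ) (hK : IsChannel K) (hq : ∀ y, 0 < push μ K y) :
    eta Φ μ K ∈ Set.Icc (0 : ℝ) 1 := by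
  constructor
  · apply Real.sSup_nonneg
    rintro r ⟨ν, hν, -, rfl⟩
    exact (fDiv_push_div_mem_Icc hconv hμ hK hq hν).1
  · refine Real.sSup_le ?_ zero_le_one
    rintro r ⟨ν, hν, -, rfl⟩
    exact (fDiv_push_div_mem_Icc hconv hμ hK hq hν).2

lemma fDiv_push_le_eta_mul (hconv : ConvexOn ℝ (Set.Ici 0) Φ)
    (hμ : IsPosDist μ) (hK : IsChannel K) (hq : ∀ y, 0 < push μ K y)
    {ν : X → ℝ} (hν : IsDist ν) :
    fDiv Φ (push ν K) (push μ K) ≤ eta Φ μ K * fDiv Φ ν μ := by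
  rcases (fDiv_nonneg hconv hμ hν).eq_or_lt with h | h
  · simpa [← h] using fDiv_push_le hconv hμ hν hK
  · rw [← div_le_iff₀ h]
    refine le_csSup ⟨1, ?_⟩ ⟨ν, hν, ?_, rfl⟩
    · rintro r ⟨ν, hν, -, rfl⟩
      exact (fDiv_push_div_mem_Icc hconv hμ hK hq hν).2
    · rintro rfl
      refine h.ne' ?_
      have e : ∀ x, ν x / ν x = 1 := fun x => div_self (hμ.1 x).ne'
      simp [fDiv, e, ← Finset.sum_mul, hμ.2]

/-- For a homogeneous `Φ`-entropy the SDPI extends from densities to nonnegative functions. -/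
lemma Ent_condExp_le_eta_mul (hconv : ConvexOn ℝ (Set.Ici 0) Φ) (hhom : Homogeneous Φ)
    (hμ : IsPosDist μ) (hK : IsChannel K) (hq : ∀ y, 0 < push μ K y)
    {f : X → ℝ} (hf : ∀ x, 0 ≤ f x) :
    Ent Φ (push μ K) (condExp μ K f) ≤ eta Φ μ K * Ent Φ μ f := by
  have hq' := hμ.isDist.push hK
  have hm0 : 0 ≤ ∑ x, μ x * f x := Finset.sum_nonneg fun x _ => mul_nonneg (hμ.1 x).le (hf x)
  rcases hm0.eq_or_lt with h | h
  · have hf0 : ∀ x, f x = 0 := fun x => by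
      have := (Finset.sum_eq_zero_iff_of_nonneg
        fun x _ => mul_nonneg (hμ.1 x).le (hf x)).1 h.symm x (mem_univ x)
      exact (mul_eq_zero.1 this).resolve_left (hμ.1 x).ne'
    simp [Ent, condExp, hf0, ← Finset.sum_mul, hμ.2, hq'.2]
  · obtain ⟨κ, hκ, hhom⟩ := hhom
    set m := ∑ x, μ x * f x with hm
    have hμ0 : ∀ x, μ x ≠ 0 := fun x => (hμ.1 x).ne'
    have hq0 : ∀ y, push μ K y ≠ 0 := fun y => (hq y).ne'
    let ν : X → ℝ := fun x => μ x * f x / m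
    have hν : IsDist ν := ⟨fun x => div_nonneg (mul_nonneg (hμ.1 x).le (hf x)) h.le, by
      rw [← Finset.sum_div, ← hm, div_self h.ne']⟩
    have hνK := hν.push hK
    have e1 : Ent Φ μ f = κ m * fDiv Φ ν μ := by
      have := hhom m h X μ hμ.isDist (fun x => ν x / μ x)
        fun x => div_nonneg (hν.1 x) (hμ.1 x).le
      have e : (fun x => m * (ν x / μ x)) = f := by
        funext x
        have := hμ0 x
        simp only [ν]
        field_simp
      have e' : ∑ x, μ x * (ν x / μ x) = 1 := by
        rw [← hν.2]
        exact Finset.sum_congr rfl fun x _ => mul_div_cancel₀ _ (hμ0 x)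
      rw [e] at this
      rw [this, Ent, e', fDiv]
    have e2 : Ent Φ (push μ K) (condExp μ K f) =
        κ m * fDiv Φ (push ν K) (push μ K) := by
      have := hhom m h Y (push μ K) hq' (fun y => push ν K y / push μ K y)
        fun y => div_nonneg (hνK.1 y) (hq y).le
      have e : (fun y => m * (push ν K y / push μ K y)) = condExp μ K f := by
        funext y
        rw [condExp, mul_div_assoc']
        congr 1
        rw [SDPI.push, Finset.mul_sum]
        refine Finset.sum_congr rfl fun x _ => ?_
        simp only [ν]
        field_simp
      have e' : ∑ y, push μ K y * (push ν K y / push μ K y) = 1 := by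
        rw [← hνK.2]
        exact Finset.sum_congr rfl fun y _ => mul_div_cancel₀ _ (hq0 y)
      rw [e] at this
      rw [this, Ent, e', fDiv]
    rw [e1, e2, mul_left_comm]
    exact mul_le_mul_of_nonneg_left (fDiv_push_le_eta_mul hconv hμ hK hq hν) (hκ m h).le

end eta

section product

variable {ι : Type} [Fintype ι] [DecidableEq ι] {Xs : ι → Type}

lemma prod_update_eq_mul_prod_erase (μ : ∀ i, Xs i → ℝ) (i : ι) (z : ∀ j, Xs j) (w : Xs i) :
    ∏ j, μ j (Function.update z i w j) = μ i w * ∏ j ∈ univ.erase i, μ j (z j) := by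
  rw [← Finset.mul_prod_erase _ _ (mem_univ i), Function.update_self]
  congr 1
  exact Finset.prod_congr rfl fun j hj => by rw [Function.update_of_ne (Finset.ne_of_mem_erase hj)]

variable [∀ i, Fintype (Xs i)]

/-- Resampling one coordinate of a product distribution. -/
lemma sum_prod_mul_sum_update (μ : ∀ i, Xs i → ℝ) (i : ι) (hμ : ∑ w, μ i w = 1)
    (G : (∀ j, Xs j) → ℝ) :
    ∑ z : ∀ j, Xs j, (∏ j, μ j (z j)) * ∑ w, G (Function.update z i w) =
      ∑ z : ∀ j, Xs j, (∏ j ∈ univ.erase i, μ j (z j)) * G z := by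
  have hswap : Function.Involutive fun a : (∀ j, Xs j) × Xs i =>
      (Function.update a.1 i a.2, a.1 i) := fun a => by simp
  calc ∑ z : ∀ j, Xs j, (∏ j, μ j (z j)) * ∑ w, G (Function.update z i w)
      = ∑ a : (∀ j, Xs j) × Xs i, (∏ j, μ j (a.1 j)) * G (Function.update a.1 i a.2) := by
        simp only [Fintype.sum_prod_type, Finset.mul_sum]
    _ = ∑ a : (∀ j, Xs j) × Xs i, (∏ j, μ j (Function.update a.1 i a.2 j)) * G a.1 := by
        rw [← Equiv.sum_comp hswap.toPerm]
        simp
    _ = _ := by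
        simp only [Fintype.sum_prod_type, prod_update_eq_mul_prod_erase, ← Finset.sum_mul, hμ,
          one_mul]

lemma sum_prod_mul_average_update (μ : ∀ i, Xs i → ℝ) (i : ι) (hμ : ∑ w, μ i w = 1)
    (G : (∀ j, Xs j) → ℝ) :
    ∑ z : ∀ j, Xs j, (∏ j, μ j (z j)) * ∑ w, μ i w * G (Function.update z i w) =
      ∑ z : ∀ j, Xs j, (∏ j, μ j (z j)) * G z := by
  have := sum_prod_mul_sum_update μ i hμ fun z => μ i (z i) * G z
  simp only [Function.update_self] at this
  rw [this]
  refine Finset.sum_congr rfl fun z _ => ?_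
  rw [← Finset.mul_prod_erase univ (fun j => μ j (z j)) (mem_univ i)]
  ring

lemma sum_mul_prod_erase_ite [∀ i, DecidableEq (Xs i)] (i : ι) (A : (∀ j, Xs j) → ℝ)
    (z : ∀ j, Xs j) :
    ∑ x : ∀ j, Xs j, A x * ∏ j ∈ univ.erase i, (if z j = x j then (1 : ℝ) else 0) =
      ∑ w, A (Function.update z i w) := by
  symm
  refine Finset.sum_of_injOn (fun w => Function.update z i w)
    (Function.update_injective z i).injOn (fun _ _ => by simp) ?_ ?_
  · intro x _ hx
    obtain ⟨j, hj, hne⟩ : ∃ j, j ≠ i ∧ z j ≠ x j := by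
      by_contra! h
      refine hx ⟨x i, by simp, ?_⟩
      funext j
      by_cases hj : j = i
      · subst hj; simp
      · simp [hj, h j hj]
    rw [Finset.prod_eq_zero (Finset.mem_erase.2 ⟨hj, mem_univ j⟩) (if_neg hne), mul_zero]
  · intro w _
    rw [Finset.prod_eq_one, mul_one]
    intro j hj
    simp [Finset.ne_of_mem_erase hj]

/-- Applying a channel to one coordinate contracts the `Φ`-entropy of that coordinate only. -/
lemma sum_localChannel_le {Φ : ℝ → ℝ}
    (hconv : ConvexOn ℝ (Set.Ici 0) Φ) (hhom : Homogeneous Φ)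
    {μ : ∀ i, Xs i → ℝ} (hμ : ∀ i, IsPosDist (μ i)) (i : ι) {K : Xs i → Xs i → ℝ}
    (hK : IsChannel K) (hq : ∀ y, 0 < push (μ i) K y)
    {f : (∀ j, Xs j) → ℝ} (hf : ∀ z, 0 ≤ f z) :
    ∑ z : ∀ j, Xs j, (push (μ i) K (z i) * ∏ j ∈ univ.erase i, μ j (z j)) *
        Φ (condExp (μ i) K (fun w => f (Function.update z i w)) (z i)) ≤
      (∑ z : ∀ j, Xs j, (∏ j, μ j (z j)) * Φ (f z)) - (1 - eta Φ (μ i) K) *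
        ((∑ z : ∀ j, Xs j, (∏ j, μ j (z j)) * Φ (f z)) -
          ∑ z : ∀ j, Xs j, (∏ j, μ j (z j)) *
            Φ (∑ w : Xs i, μ i w * f (Function.update z i w))) := by
  have e1 := sum_prod_mul_sum_update μ i (hμ i).2
    fun z => push (μ i) K (z i) * Φ (condExp (μ i) K (fun w => f (Function.update z i w)) (z i))
  have e2 := sum_prod_mul_average_update μ i (hμ i).2 fun z => Φ (f z)
  simp only [Function.update_self, Function.update_idem] at e1
  calc _ = ∑ z : ∀ j, Xs j, (∏ j, μ j (z j)) * ∑ y, push (μ i) K y *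
        Φ (condExp (μ i) K (fun w => f (Function.update z i w)) y) := by
        rw [e1]
        exact Finset.sum_congr rfl fun z _ => by ring
    _ ≤ ∑ z : ∀ j, Xs j, (∏ j, μ j (z j)) *
        (eta Φ (μ i) K * ∑ w, μ i w * Φ (f (Function.update z i w)) +
          (1 - eta Φ (μ i) K) * Φ (∑ w : Xs i, μ i w * f (Function.update z i w))) := by
        refine Finset.sum_le_sum fun z _ => mul_le_mul_of_nonneg_left ?_
          (Finset.prod_nonneg fun j _ => ((hμ j).1 _).le)
        have h := Ent_condExp_le_eta_mul hconv hhom (hμ i) hK hq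
          (f := fun w => f (Function.update z i w)) fun w => hf _
        have e : ∑ y, push (μ i) K y *
            condExp (μ i) K (fun w => f (Function.update z i w)) y =
            ∑ w, μ i w * f (Function.update z i w) := by
          simp only [condExp, mul_div_cancel₀ _ (hq _).ne']
          rw [Finset.sum_comm]
          refine Finset.sum_congr rfl fun x _ => ?_
          rw [← Finset.sum_mul, ← Finset.mul_sum, hK.2, mul_one]
        rw [Ent, Ent, e] at h
        linarith
    _ = _ := by
        simp only [mul_add, mul_left_comm _ (eta Φ (μ i) K), mul_left_comm _ (1 - eta Φ (μ i) K),
          Finset.sum_add_distrib, ← Finset.mul_sum, e2]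
        ring

/-- The mixture of local channels pushes `(⨂ μ) f` to the mixture of the products with `i`-th factor
`μᵢKᵢ`, each times the conditional expectation of `f` along coordinate `i`. -/
lemma push_mixture [∀ i, DecidableEq (Xs i)]
    (μ : ∀ i, Xs i → ℝ) (K : ∀ i, Xs i → Xs i → ℝ)
    (p : ι → ℝ) (hq : ∀ i y, 0 < push (μ i) (K i) y) (f : (∀ j, Xs j) → ℝ) (z : ∀ j, Xs j) :
    push (fun x : ∀ i, Xs i => (∏ i, μ i (x i)) * f x)
        (fun (x x' : ∀ i, Xs i) => ∑ i, p i * K i (x i) (x' i) *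
          ∏ j ∈ univ.erase i, (if x' j = x j then (1 : ℝ) else 0)) z =
      ∑ i, p i * (push (μ i) (K i) (z i) * ∏ j ∈ univ.erase i, μ j (z j)) *
        condExp (μ i) (K i) (fun w => f (Function.update z i w)) (z i) := by
  simp only [push, Finset.mul_sum (s := (univ : Finset ι))]
  rw [Finset.sum_comm]
  refine Finset.sum_congr rfl fun i _ => ?_
  have h := sum_mul_prod_erase_ite i
    (fun x => (∏ j, μ j (x j)) * f x * (p i * K i (x i) (z i))) z
  simp only [mul_assoc] at h ⊢
  rw [h]
  have hc : push (μ i) (K i) (z i) *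
      condExp (μ i) (K i) (fun w => f (Function.update z i w)) (z i) =
      ∑ w, μ i w * K i w (z i) * f (Function.update z i w) :=
    mul_div_cancel₀ _ (hq i _).ne'
  change _ = p i * (push (μ i) (K i) (z i) * _)
  rw [mul_left_comm (push (μ i) (K i) (z i)), hc, Finset.mul_sum, Finset.mul_sum]
  refine Finset.sum_congr rfl fun w _ => ?_
  rw [prod_update_eq_mul_prod_erase, Function.update_self]
  ring

end product

/-- Theorem (mixtures of local channels): if the `Φ`-entropy is subadditive and
homogeneous, `(μᵢ,Kᵢ)` are admissible pairs with `Kᵢ : Xᵢ → Xᵢ`, and `p` is a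
probability vector, then for the mixture channel
`K = Σᵢ pᵢ (id ⊗ ⋯ ⊗ Kᵢ ⊗ ⋯ ⊗ id)` one has
`1 − η_Φ(μ₁⊗⋯⊗μₙ, K) ≥ minᵢ pᵢ(1 − η_Φ(μᵢ,Kᵢ))`. -/
theorem statement9 (Φ : ℝ → ℝ) (hconv : ConvexOn ℝ (Set.Ici 0) Φ)
    (hsub : Subadditive Φ) (hhom : Homogeneous Φ)
    (n : ℕ) (hn : 0 < n)
    (Xs : Fin n → Type) [∀ i, Fintype (Xs i)] [∀ i, DecidableEq (Xs i)]
    [∀ i, Nonempty (Xs i)]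
    (μ : ∀ i, Xs i → ℝ) (K : ∀ i, Xs i → Xs i → ℝ)
    (hμ : ∀ i, IsPosDist (μ i)) (hK : ∀ i, IsChannel (K i))
    (hadm : ∀ i x', 0 < push (μ i) (K i) x')
    (p : Fin n → ℝ) (hp0 : ∀ i, 0 ≤ p i) (hp1 : ∑ i, p i = 1) :
    Finset.univ.inf' (Finset.univ_nonempty_iff.mpr ⟨⟨0, hn⟩⟩)
        (fun i => p i * (1 - eta Φ (μ i) (K i))) ≤
      1 - eta Φ (fun x : ∀ i, Xs i => ∏ i, μ i (x i))
        (fun (x x' : ∀ i, Xs i) => ∑ i, p i * K i (x i) (x' i) *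
          ∏ j ∈ Finset.univ.erase i, (if x' j = x j then (1:ℝ) else 0)) := by
  have hn' : (univ : Finset (Fin n)).Nonempty := Finset.univ_nonempty_iff.mpr ⟨⟨0, hn⟩⟩
  set c := univ.inf' hn' fun i => p i * (1 - eta Φ (μ i) (K i))
  have hη : ∀ i, eta Φ (μ i) (K i) ∈ Set.Icc (0 : ℝ) 1 :=
    fun i => eta_mem_Icc hconv (hμ i) (hK i) (hadm i)
  have hci : ∀ i, c ≤ p i * (1 - eta Φ (μ i) (K i)) :=
    fun i => Finset.inf'_le _ (mem_univ i)
  have hc0 : 0 ≤ c := Finset.le_inf' _ _ fun i _ => mul_nonneg (hp0 i) (sub_nonneg.2 (hη i).2)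
  have hc1 : c ≤ 1 := by
    let i : Fin n := ⟨0, hn⟩
    have hpi : p i ≤ 1 := hp1 ▸ Finset.single_le_sum (fun i _ => hp0 i) (mem_univ i)
    exact (hci i).trans (mul_le_one₀ hpi (sub_nonneg.2 (hη i).2) (sub_le_self _ (hη i).1))
  have hW : IsPosDist fun x : ∀ i, Xs i => ∏ i, μ i (x i) :=
    ⟨fun x => Finset.prod_pos fun i _ => (hμ i).1 _, by
      rw [← Fintype.prod_sum]
      exact Finset.prod_eq_one fun i _ => (hμ i).2⟩
  suffices h : eta Φ (fun x : ∀ i, Xs i => ∏ i, μ i (x i))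
      (fun (x x' : ∀ i, Xs i) => ∑ i, p i * K i (x i) (x' i) *
        ∏ j ∈ Finset.univ.erase i, (if x' j = x j then (1:ℝ) else 0)) ≤ 1 - c by
    linarith
  refine Real.sSup_le ?_ (sub_nonneg.2 hc1)
  rintro r ⟨ν, hν, -, rfl⟩
  refine div_le_of_le_mul₀ (fDiv_nonneg hconv hW hν) (sub_nonneg.2 hc1) ?_
  set f : (∀ i, Xs i) → ℝ := fun x => ν x / ∏ i, μ i (x i)
  have hf0 : ∀ z, 0 ≤ f z := fun z => div_nonneg (hν.1 z) (hW.1 z).le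
  have hWf : ν = fun x => (∏ i, μ i (x i)) * f x :=
    funext fun x => (mul_div_cancel₀ _ (hW.1 x).ne').symm
  have hmean : ∑ x : ∀ i, Xs i, (∏ i, μ i (x i)) * f x = 1 := by
    rw [← hν.2]
    exact Finset.sum_congr rfl fun x _ => (congrFun hWf x).symm
  have hcond0 : ∀ i z, 0 ≤ condExp (μ i) (K i) (fun w => f (Function.update z i w)) (z i) :=
    fun i z => div_nonneg (Finset.sum_nonneg fun w _ =>
      mul_nonneg (mul_nonneg ((hμ i).1 w).le ((hK i).1 _ _)) (hf0 _)) (hadm i _).le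
  have hlocal := fun i => sum_localChannel_le hconv hhom hμ i (hK i) (hadm i) hf0
  have hS := hsub n Xs μ (fun i => (hμ i).isDist) f hf0
  rw [Ent, hmean] at hS
  change _ ≤ (1 - c) * ((∑ z : ∀ j, Xs j, (∏ j, μ j (z j)) * Φ (f z)) - Φ 1)
  set A := ∑ z : ∀ j, Xs j, (∏ j, μ j (z j)) * Φ (f z) with hA
  have hEnt : ∀ i, 0 ≤ A - ∑ z : ∀ j, Xs j, (∏ j, μ j (z j)) *
      Φ (∑ w : Xs i, μ i w * f (Function.update z i w)) := fun i => by
    rw [hA, ← sum_prod_mul_average_update μ i (hμ i).2 fun z => Φ (f z),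
      ← Finset.sum_sub_distrib]
    refine Finset.sum_nonneg fun z _ => ?_
    rw [← mul_sub]
    exact mul_nonneg (hW.1 z).le (Ent_nonneg hconv (hμ i).isDist fun w => hf0 _)
  set D : Fin n → ℝ := fun i => A - ∑ z : ∀ j, Xs j, (∏ j, μ j (z j)) *
      Φ (∑ w : Xs i, μ i w * f (Function.update z i w)) with hD
  have hpushW := push_mixture μ K p hadm fun _ => 1
  have hone : ∀ i y, condExp (μ i) (K i) (fun _ => 1) y = 1 := fun i y => by
    simpa [condExp, push] using div_self (hadm i y).ne'
  simp only [mul_one, hone] at hpushW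
  have hpushν := push_mixture μ K p hadm f
  rw [← hWf] at hpushν
  have hmain : ∑ z, push (fun x : ∀ i, Xs i => ∏ i, μ i (x i))
      (fun (x x' : ∀ i, Xs i) => ∑ i, p i * K i (x i) (x' i) *
        ∏ j ∈ Finset.univ.erase i, (if x' j = x j then (1:ℝ) else 0)) z *
      Φ (push ν (fun (x x' : ∀ i, Xs i) => ∑ i, p i * K i (x i) (x' i) *
        ∏ j ∈ Finset.univ.erase i, (if x' j = x j then (1:ℝ) else 0)) z /
        push (fun x : ∀ i, Xs i => ∏ i, μ i (x i))
      (fun (x x' : ∀ i, Xs i) => ∑ i, p i * K i (x i) (x' i) *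
        ∏ j ∈ Finset.univ.erase i, (if x' j = x j then (1:ℝ) else 0)) z) ≤
      A - c * ∑ i, D i := by
    calc _ ≤ ∑ z : ∀ j, Xs j, ∑ i,
          p i * (push (μ i) (K i) (z i) * ∏ j ∈ univ.erase i, μ j (z j)) *
          Φ (condExp (μ i) (K i) (fun w => f (Function.update z i w)) (z i)) := by
          refine Finset.sum_le_sum fun z _ => ?_
          rw [hpushW, hpushν]
          exact sum_mul_map_div_le hconv (fun i => mul_nonneg (hp0 i) (mul_nonneg (hadm i _).le
            (Finset.prod_nonneg fun j _ => ((hμ j).1 _).le))) fun i => hcond0 i z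
      _ = ∑ i, p i * ∑ z : ∀ j, Xs j,
          (push (μ i) (K i) (z i) * ∏ j ∈ univ.erase i, μ j (z j)) *
          Φ (condExp (μ i) (K i) (fun w => f (Function.update z i w)) (z i)) := by
          rw [Finset.sum_comm]
          simp only [Finset.mul_sum, mul_assoc]
      _ ≤ ∑ i, (p i * A - c * D i) := by
          refine Finset.sum_le_sum fun i _ => ?_
          have h1 := mul_le_mul_of_nonneg_left (hlocal i) (hp0 i)
          have h2 := mul_le_mul_of_nonneg_right (hci i) (hEnt i)
          simp only [hD]
          linarith
      _ = A - c * ∑ i, D i := by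
          rw [Finset.sum_sub_distrib, ← Finset.sum_mul, hp1, one_mul, Finset.mul_sum]
  have h3 := mul_le_mul_of_nonneg_left hS hc0
  rw [fDiv]
  linarith

end SDPI
end
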